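/- arXiv:1607.07526 — 2 statements merged into one kernel-verified Lean document; each statement's English description precedes it below -/
import Mathlib

section
/- Fix μ > 0 and cover X = [0,1]^d by r = (1/μ)^d axis-aligned boxes of side length μ. Let S_n be n i.i.d. samples from a distribution on X, and for x ∈ X let π₁(x) denote a nearest sample point to x in the Euclidean norm. Then E_{x,S_n}[‖x - x_{π₁(x)}‖] ≤ √d·(μ + r/(n·e)), and choosing μ = (d/(ne))^{1/(d+1)} yields E_{x,S_n}[‖x - x_{π₁(x)}‖] ≤ (3/2)·√d / n^{1/(d+1)}. -/
open MeasureTheory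
open scoped ENNReal

open Finset in
/-- If `f S` is bounded by `M` and by `g` at every sample point, split according to the first sample
that falls in `C` to bound its mean. -/
theorem lintegral_pi_le_of_le_apply {E : Type*} [MeasurableSpace E] (μ : Measure E)
    [IsProbabilityMeasure μ] {C : Set E} (hC : MeasurableSet C) (g : E → ℝ≥0∞) (M : ℝ≥0∞)
    (n : ℕ) (f : (Fin n → E) → ℝ≥0∞) (hf : Measurable f) (hM : ∀ S, f S ≤ M)
    (hg : ∀ S i, f S ≤ g (S i)) :
    ∫⁻ S, f S ∂(Measure.pi fun _ : Fin n => μ) ≤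
      μ Cᶜ ^ n * M + (∑ i ∈ range n, μ Cᶜ ^ i) * ∫⁻ y in C, g y ∂μ := by
  induction n with
  | zero =>
    calc _ ≤ ∫⁻ _, M ∂(Measure.pi fun _ : Fin 0 => μ) := lintegral_mono hM
      _ ≤ _ := by simp
  | succ n ih =>
    have hmp := (measurePreserving_piFinSuccAbove (fun _ : Fin (n + 1) => μ) 0).symm
    rw [← hmp.lintegral_comp_emb (MeasurableEquiv.measurableEmbedding _),
      lintegral_prod _ (by fun_prop)]
    set K := μ Cᶜ ^ n * M + (∑ i ∈ range n, μ Cᶜ ^ i) * ∫⁻ y in C, g y ∂μ with hK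
    rw [← lintegral_add_compl _ hC]
    have h1 : ∫⁻ y in C, ∫⁻ S, f ((MeasurableEquiv.piFinSuccAbove (fun _ => E) 0).symm (y, S))
        ∂(Measure.pi fun _ : Fin n => μ) ∂μ ≤ ∫⁻ y in C, g y ∂μ := by
      refine lintegral_mono fun y => ?_
      calc _ ≤ ∫⁻ _, g y ∂(Measure.pi fun _ : Fin n => μ) :=
            lintegral_mono fun S =>
              (hg _ 0).trans_eq (by simp [Fin.consEquiv])
        _ = g y := by simp
    have h2 : ∫⁻ y in Cᶜ, ∫⁻ S, f ((MeasurableEquiv.piFinSuccAbove (fun _ => E) 0).symm (y, S))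
        ∂(Measure.pi fun _ : Fin n => μ) ∂μ ≤ ∫⁻ y in Cᶜ, K ∂μ := by
      refine lintegral_mono fun y => ih _ (by fun_prop) (fun _ => hM _) fun S i => ?_
      simpa using hg ((MeasurableEquiv.piFinSuccAbove (fun _ => E) 0).symm (y, S)) i.succ
    refine (add_le_add h1 h2).trans (le_of_eq ?_)
    simp only [lintegral_const, Measure.restrict_apply_univ, hK, sum_range_succ', pow_succ,
      ← sum_mul, pow_zero]
    ring

/-- Two independent points of a set of circumradius at most `σ / √2` are at mean distance at most
`σ`. -/
theorem setLIntegral_setLIntegral_norm_sub_le {E : Type*} [NormedAddCommGroup E]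
    [InnerProductSpace ℝ E] [CompleteSpace E] [MeasurableSpace E] [BorelSpace E]
    [SecondCountableTopology E]
    (μ : Measure E) [IsFiniteMeasure μ] {C : Set E} (hC : MeasurableSet C) (c : E) {σ : ℝ}
    (hσ : 0 < σ) (h : ∀ x ∈ C, ‖x - c‖ ^ 2 ≤ σ ^ 2 / 2) :
    ∫⁻ x in C, ∫⁻ y in C, ENNReal.ofReal ‖x - y‖ ∂μ ∂μ ≤ ENNReal.ofReal (σ * μ.real C ^ 2) := by
  have hpt : ∀ x ∈ C, ∀ y ∈ C, ‖x - y‖ ≤ σ - σ⁻¹ * inner ℝ (x - c) (y - c) := by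
    intro x hx y hy
    have h1 := norm_sub_sq_real (x - c) (y - c)
    rw [sub_sub_sub_cancel_right] at h1
    have h2 := sq_nonneg (‖x - y‖ - σ)
    have h3 := h x hx
    have h4 := h y hy
    have : σ * ‖x - y‖ ≤ σ * (σ - σ⁻¹ * inner ℝ (x - c) (y - c)) := by
      field_simp
      nlinarith
    exact le_of_mul_le_mul_left this hσ
  have hint : Integrable (fun x => x - c) (μ.restrict C) := by
    refine Integrable.of_bound (by fun_prop) σ ?_
    filter_upwards [ae_restrict_mem hC] with x hx
    nlinarith [h x hx, norm_nonneg (x - c)]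
  set v := ∫ y in C, (y - c) ∂μ with hv
  have hin : ∀ x : E, ∫ y in C, (σ - σ⁻¹ * inner ℝ (x - c) (y - c)) ∂μ
      = σ * μ.real C - σ⁻¹ * inner ℝ (x - c) v := by
    intro x
    rw [integral_sub (by fun_prop) ((hint.const_inner (x - c)).const_mul _), integral_const_mul,
      integral_inner hint]
    simp [mul_comm, hv]
  have hinner : ∀ x ∈ C, ∫⁻ y in C, ENNReal.ofReal ‖x - y‖ ∂μ
      ≤ ENNReal.ofReal (σ * μ.real C - σ⁻¹ * inner ℝ (x - c) v) := by
    intro x hx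
    have hi : Integrable (fun y => σ - σ⁻¹ * inner ℝ (x - c) (y - c)) (μ.restrict C) :=
      (integrable_const _).sub ((hint.const_inner (x - c)).const_mul _)
    rw [← hin, ofReal_integral_eq_lintegral_ofReal hi]
    · refine setLIntegral_mono' hC fun y hy => ENNReal.ofReal_le_ofReal (hpt x hx y hy)
    · filter_upwards [ae_restrict_mem hC] with y hy
      exact (norm_nonneg _).trans (hpt x hx y hy)
  have hnn : ∀ x ∈ C, 0 ≤ σ * μ.real C - σ⁻¹ * inner ℝ (x - c) v := by
    intro x hx
    rw [← hin]
    exact setIntegral_nonneg hC fun y hy => (norm_nonneg _).trans (hpt x hx y hy)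
  have hint' : Integrable (fun x => σ⁻¹ * inner ℝ (x - c) v) (μ.restrict C) :=
    (hint.inner_const v).const_mul _
  refine (setLIntegral_mono' hC hinner).trans ?_
  have hi : Integrable (fun x => σ * μ.real C - σ⁻¹ * inner ℝ (x - c) v) (μ.restrict C) :=
    (integrable_const _).sub hint'
  rw [← ofReal_integral_eq_lintegral_ofReal hi]
  · refine ENNReal.ofReal_le_ofReal ?_
    have hv2 : ∫ x in C, inner ℝ (x - c) v ∂μ = ‖v‖ ^ 2 := by
      simp_rw [real_inner_comm v]
      rw [integral_inner hint, ← hv, real_inner_self_eq_norm_sq]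
    rw [integral_sub (by fun_prop) hint', integral_const_mul σ⁻¹, hv2]
    have : 0 ≤ σ⁻¹ * ‖v‖ ^ 2 := by positivity
    simp only [integral_const, measureReal_restrict_apply_univ, smul_eq_mul]
    nlinarith
  · filter_upwards [ae_restrict_mem hC] with x hx using hnn x hx

theorem mul_one_sub_pow_le {p : ℝ} (hp : 0 ≤ p) (hp1 : p ≤ 1) {n : ℕ} (hn : 1 ≤ n) :
    p * (1 - p) ^ n ≤ 1 / (n * Real.exp 1) := by
  have hn' : (0 : ℝ) < n := by exact_mod_cast hn
  have h1 : (1 - p) ^ n ≤ Real.exp (-(n * p)) := by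
    calc (1 - p) ^ n ≤ Real.exp (-p) ^ n :=
          pow_le_pow_left₀ (by linarith) (Real.one_sub_le_exp_neg p) n
      _ = _ := by rw [← Real.exp_nat_mul]; ring_nf
  have h2 : n * p ≤ Real.exp (n * p - 1) := by linarith [Real.add_one_le_exp (n * p - 1)]
  rw [le_div_iff₀ (by positivity)]
  calc p * (1 - p) ^ n * (n * Real.exp 1)
      ≤ p * Real.exp (-(n * p)) * (n * Real.exp 1) := by gcongr
    _ = (n * p) * (Real.exp (-(n * p)) * Real.exp 1) := by ring
    _ ≤ Real.exp (n * p - 1) * (Real.exp (-(n * p)) * Real.exp 1) := by gcongr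
    _ = 1 := by rw [← Real.exp_add, ← Real.exp_add]; simp

theorem sq_le_of_pow_le_mul_two_pow {d j : ℕ} (hj : j < d) {B : ℝ} (hB : 0 ≤ B)
    (h : B ^ d ≤ 4 / 3 * 2 ^ j) : B ^ 2 ≤ 1 + (3 * j + 7 / 9) / d := by
  have hd : (0 : ℝ) < d := by exact_mod_cast (by omega : 0 < d)
  have hjd : (j : ℝ) + 1 ≤ d := by exact_mod_cast hj
  have key := Real.geom_mean_le_arith_mean3_weighted (w₁ := 1 / d) (w₂ := j / d)
    (w₃ := (d - 1 - j) / d) (p₁ := 16 / 9) (p₂ := 4) (p₃ := 1) (by positivity) (by positivity)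
    (div_nonneg (by linarith) hd.le) (by norm_num) (by norm_num) (by norm_num)
    (by field_simp; ring)
  have h1 : ((B ^ 2) ^ d) ^ ((1 : ℝ) / d) = B ^ 2 := by
    rw [one_div]; exact Real.pow_rpow_inv_natCast (by positivity) (by omega)
  have h2 : (B ^ 2) ^ d ≤ 16 / 9 * 4 ^ j := by
    calc (B ^ 2) ^ d = (B ^ d) ^ 2 := by ring
      _ ≤ (4 / 3 * 2 ^ j) ^ 2 := by gcongr
      _ = 16 / 9 * 4 ^ j := by rw [mul_pow, ← pow_mul, mul_comm j, pow_mul]; norm_num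
  have h3 : ((16 / 9 : ℝ) * 4 ^ j) ^ ((1 : ℝ) / d) =
      (16 / 9 : ℝ) ^ ((1 : ℝ) / d) * (4 : ℝ) ^ ((j : ℝ) / d) := by
    rw [Real.mul_rpow (by norm_num) (by positivity),
      ← Real.rpow_natCast, ← Real.rpow_mul (by norm_num)]
    ring_nf
  have h4 := Real.rpow_le_rpow (by positivity) h2 (by positivity : (0 : ℝ) ≤ 1 / d)
  rw [h1, h3] at h4
  rw [Real.one_rpow, mul_one] at key
  refine (h4.trans key).trans (le_of_eq ?_)
  field_simp
  ring

/-- Cutting `j` axes of the unit cube into `k + 1` parts and the others into `k` parts, one can make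
the cells of normalised size `s ≤ 1 / B` while keeping their number below `B ^ d / (1 - s)`. -/
theorem exists_grid {d : ℕ} (hd : 1 ≤ d) {B : ℝ} (hB : 1 ≤ B) :
    ∃ k j : ℕ, 1 ≤ k ∧ j ≤ d ∧ ∃ s : ℝ, 0 < s ∧ s ≤ 1 ∧ s * B ≤ 1 ∧
      2 * d * s ^ 2 = j / ((k : ℝ) + 1) ^ 2 + (d - j) / (k : ℝ) ^ 2 ∧
      (1 - s) * (((k : ℝ) + 1) ^ j * (k : ℝ) ^ (d - j)) ≤ B ^ d := by
  have hd0 : (0 : ℝ) < d := by exact_mod_cast hd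
  have red : ∀ k j : ℕ, 1 ≤ k → j ≤ d → ∀ s0 : ℝ, 0 ≤ s0 →
      2 * d * s0 ^ 2 ≤ j / ((k : ℝ) + 1) ^ 2 + (d - j) / (k : ℝ) ^ 2 →
      (j / ((k : ℝ) + 1) ^ 2 + (d - j) / (k : ℝ) ^ 2) * B ^ 2 ≤ 2 * d →
      (1 - s0) * (((k : ℝ) + 1) ^ j * (k : ℝ) ^ (d - j)) ≤ B ^ d →
      ∃ k j : ℕ, 1 ≤ k ∧ j ≤ d ∧ ∃ s : ℝ, 0 < s ∧ s ≤ 1 ∧ s * B ≤ 1 ∧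
      2 * d * s ^ 2 = j / ((k : ℝ) + 1) ^ 2 + (d - j) / (k : ℝ) ^ 2 ∧
      (1 - s) * (((k : ℝ) + 1) ^ j * (k : ℝ) ^ (d - j)) ≤ B ^ d := by
    intro k j hk hj s0 hs0 h1 h2 h3
    have hk0 : (0 : ℝ) < k := by exact_mod_cast hk
    have hj0 : (j : ℝ) ≤ d := by exact_mod_cast hj
    set T := j / ((k : ℝ) + 1) ^ 2 + (d - j) / (k : ℝ) ^ 2 with hT
    have hTpos : 0 < T := by
      have : 0 ≤ (d - j : ℝ) / (k : ℝ) ^ 2 := div_nonneg (by linarith) (by positivity)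
      rcases Nat.eq_zero_or_pos j with rfl | hjp
      · simp only [hT, Nat.cast_zero, zero_div, zero_add, sub_zero]; positivity
      · have : (0 : ℝ) < j := by exact_mod_cast hjp
        positivity
    have hsq : √(T / (2 * d)) ^ 2 = T / (2 * d) := Real.sq_sqrt (by positivity)
    have hsB : √(T / (2 * d)) * B ≤ 1 := by
      refine le_of_sq_le_sq ?_ (by norm_num)
      rw [mul_pow, hsq, one_pow, div_mul_eq_mul_div, div_le_one (by positivity)]
      exact h2
    have hspos : 0 < √(T / (2 * d)) := Real.sqrt_pos.2 (by positivity)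
    refine ⟨k, j, hk, hj, √(T / (2 * d)), hspos, ?_, hsB, ?_, ?_⟩
    · nlinarith
    · rw [hsq, mul_div_cancel₀ _ (by positivity)]
    · refine le_trans ?_ h3
      have : s0 ≤ √(T / (2 * d)) := Real.le_sqrt_of_sq_le (by
        rw [le_div_iff₀ (by positivity)]; linarith)
      gcongr
  rcases lt_or_ge B 2 with h2 | h2
  · -- halve as many coordinates as the budget `B ^ d` allows
    set P : ℕ → Prop := fun j => 2 / 3 * (2 : ℝ) ^ j ≤ B ^ d with hP
    classical
    have hP0 : P 0 := by
      simp only [hP, pow_zero]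
      linarith [one_le_pow₀ hB (n := d)]
    set j := Nat.findGreatest P d with hjdef
    have hj : P j := Nat.findGreatest_spec (Nat.zero_le d) hP0
    have hjd : j ≤ d := Nat.findGreatest_le d
    have hjd' : (j : ℝ) ≤ d := by exact_mod_cast hjd
    refine red 1 j le_rfl hjd (1 / 3) (by norm_num) ?_ ?_ ?_
    · norm_num; linarith
    · have hT : (j / (((1 : ℕ) : ℝ) + 1) ^ 2 + (d - j) / ((1 : ℕ) : ℝ) ^ 2) = d - 3 / 4 * j := by
        norm_num; ring
      rw [hT]
      rcases hjd.eq_or_lt with h | h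
      · have : B ^ 2 ≤ 4 := by nlinarith
        rw [h]; nlinarith
      · have hn : ¬ P (j + 1) := Nat.findGreatest_is_greatest (Nat.lt_succ_self _) h
        have hlt : B ^ d ≤ 4 / 3 * 2 ^ j := by
          simp only [hP, not_le, pow_succ] at hn; linarith
        have h5 := sq_le_of_pow_le_mul_two_pow h (by linarith) hlt
        have h6 : (d - 3 / 4 * j) * B ^ 2 ≤ (d - 3 / 4 * j) * (1 + (3 * j + 7 / 9) / d) := by
          gcongr; linarith
        refine h6.trans ?_
        rw [show (1 : ℝ) + (3 * j + 7 / 9) / d = (d + 3 * j + 7 / 9) / d by field_simp; ring,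
          mul_div_assoc', div_le_iff₀ hd0]
        rcases Nat.eq_zero_or_pos j with h0 | h0
        · rw [h0]
          have : (1 : ℝ) ≤ d := by exact_mod_cast hd
          norm_num
          nlinarith
        · have : (2 : ℝ) ≤ d := by exact_mod_cast (by omega : 2 ≤ d)
          nlinarith [sq_nonneg ((d : ℝ) - 2 * j)]
    · norm_num
      exact hj
  rcases le_or_gt (B ^ 2) 8 with h8 | h8
  · refine red 2 0 (by norm_num) (Nat.zero_le _) 0 le_rfl ?_ ?_ ?_
    · norm_num; positivity
    · norm_num; nlinarith
    · simpa using pow_le_pow_left₀ (by norm_num) h2 d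
  rcases lt_or_ge B 3 with h3 | h3
  · obtain ⟨j, hj⟩ : ∃ j, j = (d + 1) / 2 := ⟨_, rfl⟩
    have hj1 : (d : ℝ) ≤ 2 * j := by exact_mod_cast (by omega : d ≤ 2 * j)
    have hj2 : (j : ℝ) ≤ d := by exact_mod_cast (by omega : j ≤ d)
    refine red 2 j (by norm_num) (by omega) (1 / 5) (by norm_num) ?_ ?_ ?_
    · norm_num
      nlinarith
    · norm_num
      have : B ^ 2 ≤ 9 := by nlinarith
      have h0 : 0 ≤ (j : ℝ) / 9 + (d - j) / 4 := by linarith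
      nlinarith
    · refine le_of_sq_le_sq ?_ (by positivity)
      have hB8 : (8 : ℝ) ^ d ≤ (B ^ d) ^ 2 := by
        rw [← pow_mul, mul_comm d, pow_mul]
        gcongr
      refine le_trans ?_ hB8
      have hsq : ((1 - 1 / 5) * ((((2 : ℕ) : ℝ) + 1) ^ j * ((2 : ℕ) : ℝ) ^ (d - j))) ^ 2 =
          16 / 25 * (9 ^ j * 4 ^ (d - j)) := by
        rw [mul_pow, mul_pow, ← pow_mul, ← pow_mul, mul_comm j, mul_comm (d - j), pow_mul, pow_mul]
        norm_num
      rw [hsq]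
      rcases Nat.even_or_odd' d with ⟨m, hm | hm⟩
      · have hjm : j = m := by omega
        rw [hjm, hm, show 2 * m - m = m by omega, pow_mul, ← mul_pow]
        have : (36 : ℝ) ^ m ≤ 64 ^ m := by gcongr; norm_num
        norm_num
        linarith [pow_pos (by norm_num : (0 : ℝ) < 36) m]
      · have hjm : j = m + 1 := by omega
        rw [hjm, hm, show 2 * m + 1 - (m + 1) = m by omega, pow_succ, pow_succ, pow_mul,
          mul_right_comm, ← mul_pow]
        have : (36 : ℝ) ^ m ≤ 64 ^ m := by gcongr; norm_num
        norm_num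
        linarith [pow_pos (by norm_num : (0 : ℝ) < 36) m]
  · set k := ⌊B⌋₊ with hk
    have hk3 : 3 ≤ k := Nat.le_floor (by exact_mod_cast h3)
    have hkB : (k : ℝ) ≤ B := Nat.floor_le (by linarith)
    have hBk : B < k + 1 := Nat.lt_floor_add_one B
    have hk3' : (3 : ℝ) ≤ k := by exact_mod_cast hk3
    refine red k 0 (by omega) (Nat.zero_le _) 0 le_rfl ?_ ?_ ?_
    · simp; positivity
    · simp only [Nat.cast_zero, zero_div, zero_add, sub_zero]
      rw [div_mul_eq_mul_div, div_le_iff₀ (by positivity), mul_right_comm, mul_comm (d : ℝ)]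
      have : B ^ 2 ≤ 2 * (k : ℝ) ^ 2 := by nlinarith
      nlinarith
    · simpa using pow_le_pow_left₀ (by positivity) hkB d

/-- The expected nearest-neighbor distance, truncated at `M`, for a distribution covered by finitely
many disjoint cells of circumradius at most `σ / √2`. -/
theorem lintegral_lintegral_le_of_partition {E α : Type*} [NormedAddCommGroup E]
    [InnerProductSpace ℝ E] [CompleteSpace E] [MeasurableSpace E] [BorelSpace E]
    [SecondCountableTopology E] [Fintype α] [MeasurableSpace α] [MeasurableSingletonClass α]
    (μ : Measure E) [IsProbabilityMeasure μ] {φ : E → α} (hφ : Measurable φ) (c : α → E)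
    {σ M : ℝ} (hσ : 0 < σ) (hσM : σ ≤ M) (hc : ∀ᵐ x ∂μ, ‖x - c (φ x)‖ ^ 2 ≤ σ ^ 2 / 2)
    {n : ℕ} (hn : 1 ≤ n) (f : E → (Fin n → E) → ℝ≥0∞) (hf : Measurable (Function.uncurry f))
    (hM : ∀ x S, f x S ≤ ENNReal.ofReal M) (hd : ∀ x S i, f x S ≤ ENNReal.ofReal ‖x - S i‖) :
    ∫⁻ x, ∫⁻ S, f x S ∂(Measure.pi fun _ : Fin n => μ) ∂μ ≤
      ENNReal.ofReal (σ + (M - σ) * (Fintype.card α / (n * Real.exp 1))) := by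
  set C : α → Set E := fun a => φ ⁻¹' {a} ∩ {x | ‖x - c a‖ ^ 2 ≤ σ ^ 2 / 2}
  have hCm : ∀ a, MeasurableSet (C a) := fun a =>
    (hφ (measurableSet_singleton a)).inter (measurableSet_le (by fun_prop) (by fun_prop))
  have hCd : Pairwise (Function.onFun Disjoint C) := by
    intro a b hab
    refine Set.disjoint_left.2 fun x hx hy => hab ?_
    exact hx.1.symm.trans hy.1
  have hCu : ∀ᵐ x ∂μ, x ∈ ⋃ a, C a := by
    filter_upwards [hc] with x hx
    exact Set.mem_iUnion.2 ⟨φ x, rfl, hx⟩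
  have hsum : ∑ a, μ.real (C a) = 1 := by
    rw [← measureReal_iUnion_fintype hCd hCm]
    have := (prob_compl_eq_zero_iff (MeasurableSet.iUnion hCm)).1 (mem_ae_iff.1 hCu)
    simp [measureReal_def, this]
  have hcell : ∀ a, ∫⁻ x in C a, ∫⁻ S, f x S ∂(Measure.pi fun _ : Fin n => μ) ∂μ ≤
      ENNReal.ofReal (σ * μ.real (C a) + (M - σ) * (1 / (n * Real.exp 1))) := by
    intro a
    set p := μ.real (C a) with hp
    have hp0 : 0 ≤ p := measureReal_nonneg
    have hp1 : p ≤ 1 := measureReal_le_one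
    have hq0 : 0 ≤ 1 - p := by linarith
    have hμC : μ (C a) = ENNReal.ofReal p := by simp [hp]
    have hμq : μ (C a)ᶜ = ENNReal.ofReal (1 - p) := by
      rw [hp, ← probReal_compl_eq_one_sub (hCm a)]; simp
    have hM0 : 0 ≤ M := by linarith
    calc ∫⁻ x in C a, ∫⁻ S, f x S ∂(Measure.pi fun _ : Fin n => μ) ∂μ
        ≤ ∫⁻ x in C a, (μ (C a)ᶜ ^ n * ENNReal.ofReal M + (∑ i ∈ Finset.range n, μ (C a)ᶜ ^ i) *
            ∫⁻ y in C a, ENNReal.ofReal ‖x - y‖ ∂μ) ∂μ := lintegral_mono fun x =>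
          lintegral_pi_le_of_le_apply μ (hCm a) _ _ n _ (by fun_prop) (hM x) (hd x)
      _ = μ (C a)ᶜ ^ n * ENNReal.ofReal M * μ (C a) + (∑ i ∈ Finset.range n, μ (C a)ᶜ ^ i) *
            ∫⁻ x in C a, ∫⁻ y in C a, ENNReal.ofReal ‖x - y‖ ∂μ ∂μ := by
          rw [lintegral_add_left (by fun_prop), lintegral_const_mul _
            (Measurable.lintegral_prod_right' (f := fun z : E × E => ENNReal.ofReal ‖z.1 - z.2‖)
              (by fun_prop))]
          simp
      _ ≤ μ (C a)ᶜ ^ n * ENNReal.ofReal M * μ (C a) + (∑ i ∈ Finset.range n, μ (C a)ᶜ ^ i) *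
            ENNReal.ofReal (σ * p ^ 2) := by
          gcongr
          exact setLIntegral_setLIntegral_norm_sub_le μ (hCm a) (c a) hσ fun x hx => hx.2
      _ = ENNReal.ofReal ((1 - p) ^ n * M * p +
            (∑ i ∈ Finset.range n, (1 - p) ^ i) * (σ * p ^ 2)) := by
          have hs0 : 0 ≤ ∑ i ∈ Finset.range n, (1 - p) ^ i :=
            Finset.sum_nonneg fun i _ => pow_nonneg hq0 i
          rw [hμC, hμq, ENNReal.ofReal_add (by positivity) (by positivity),
            ENNReal.ofReal_mul (p := (1 - p) ^ n * M) (by positivity),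
            ENNReal.ofReal_mul (p := (1 - p) ^ n) (by positivity), ENNReal.ofReal_mul hs0,
            ENNReal.ofReal_sum_of_nonneg fun i _ => pow_nonneg hq0 i,
            ENNReal.ofReal_pow hq0]
          simp_rw [ENNReal.ofReal_pow hq0]
      _ ≤ _ := by
          refine ENNReal.ofReal_le_ofReal ?_
          have hgeom : (∑ i ∈ Finset.range n, (1 - p) ^ i) * p = 1 - (1 - p) ^ n := by
            simpa using geom_sum_mul_neg (1 - p) n
          calc (1 - p) ^ n * M * p + (∑ i ∈ Finset.range n, (1 - p) ^ i) * (σ * p ^ 2)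
              = (1 - p) ^ n * M * p +
                  ((∑ i ∈ Finset.range n, (1 - p) ^ i) * p) * (σ * p) := by ring
            _ = σ * p + (M - σ) * (p * (1 - p) ^ n) := by rw [hgeom]; ring
            _ ≤ _ := by
              have := mul_le_mul_of_nonneg_left (mul_one_sub_pow_le hp0 hp1 hn)
                (sub_nonneg.2 hσM)
              linarith
  calc ∫⁻ x, ∫⁻ S, f x S ∂(Measure.pi fun _ : Fin n => μ) ∂μ
      = ∑ a, ∫⁻ x in C a, ∫⁻ S, f x S ∂(Measure.pi fun _ : Fin n => μ) ∂μ := by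
        rw [← tsum_fintype (L := .unconditional _), ← lintegral_iUnion hCm hCd,
          Measure.restrict_eq_self_of_ae_mem hCu]
    _ ≤ ∑ a, ENNReal.ofReal (σ * μ.real (C a) + (M - σ) * (1 / (n * Real.exp 1))) :=
        Finset.sum_le_sum fun a _ => hcell a
    _ = _ := by
        have hMσ := sub_nonneg.2 hσM
        rw [← ENNReal.ofReal_sum_of_nonneg fun a _ => by positivity, Finset.sum_add_distrib,
          ← Finset.mul_sum, hsum, Finset.sum_const, Finset.card_univ, nsmul_eq_mul]
        congr 1
        ring

theorem exists_cube_partition {d : ℕ} (k : Fin d → ℕ) (hk : ∀ i, 1 ≤ k i) :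
    ∃ (φ : EuclideanSpace ℝ (Fin d) → ∀ i, Fin (k i))
      (c : (∀ i, Fin (k i)) → EuclideanSpace ℝ (Fin d)), Measurable φ ∧
      ∀ x, (∀ i, x i ∈ Set.Icc (0 : ℝ) 1) →
        ‖x - c (φ x)‖ ^ 2 ≤ (∑ i, 1 / (k i : ℝ) ^ 2) / 4 := by
  refine ⟨fun x i => ⟨min ⌊k i * x i⌋₊ (k i - 1), by have := hk i; omega⟩,
    fun a => WithLp.toLp 2 fun i => ((a i : ℕ) + 1 / 2) / (k i : ℝ), ?_, fun x hx => ?_⟩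
  · refine measurable_pi_lambda _ fun i => ?_
    exact (measurable_from_nat (f := fun m : ℕ =>
      (⟨min m (k i - 1), by have := hk i; omega⟩ : Fin (k i)))).comp
      (g := fun m : ℕ => (⟨min m (k i - 1), by have := hk i; omega⟩ : Fin (k i)))
      (f := fun x : EuclideanSpace ℝ (Fin d) => ⌊k i * x i⌋₊)
      (Nat.measurable_floor.comp (by fun_prop))
  · rw [EuclideanSpace.real_norm_sq_eq, Finset.sum_div]
    refine Finset.sum_le_sum fun i _ => ?_
    obtain ⟨h0, h1⟩ := hx i
    have hk0 : (0 : ℝ) < k i := by exact_mod_cast hk i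
    set m := min ⌊k i * x i⌋₊ (k i - 1) with hm
    have hm1 : (m : ℝ) ≤ k i * x i :=
      (Nat.cast_le.2 (min_le_left _ _)).trans (Nat.floor_le (by positivity))
    have hm2 : k i * x i ≤ m + 1 := by
      rcases le_total ⌊k i * x i⌋₊ (k i - 1) with h | h
      · rw [hm, min_eq_left h]; exact (Nat.lt_floor_add_one _).le
      · rw [hm, min_eq_right h, Nat.cast_sub (hk i)]
        push_cast
        nlinarith
    have : ((x - WithLp.toLp 2 fun i => ((min ⌊k i * x i⌋₊ (k i - 1) : ℕ) + 1 / 2) / (k i : ℝ)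
        : EuclideanSpace ℝ (Fin d)) i) = (k i * x i - m - 1 / 2) / k i := by
      simp only [PiLp.sub_apply, ← hm]
      field_simp
      ring
    rw [this, div_pow, div_div, div_le_div_iff₀ (by positivity) (by positivity)]
    have : (k i * x i - m - 1 / 2) ^ 2 ≤ 1 / 4 := by nlinarith
    nlinarith [sq_nonneg (k i : ℝ), pow_pos hk0 2]

theorem norm_sub_le_sqrt_of_mem_cube {d : ℕ} {x y : EuclideanSpace ℝ (Fin d)}
    (hx : ∀ i, x i ∈ Set.Icc (0 : ℝ) 1) (hy : ∀ i, y i ∈ Set.Icc (0 : ℝ) 1) :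
    ‖x - y‖ ≤ √d := by
  refine Real.le_sqrt_of_sq_le ?_
  rw [EuclideanSpace.real_norm_sq_eq]
  calc ∑ i, (x - y) i ^ 2 ≤ ∑ _i : Fin d, (1 : ℝ) := by
        refine Finset.sum_le_sum fun i _ => ?_
        have h1 := hx i
        have h2 := hy i
        simp only [PiLp.sub_apply]
        nlinarith [h1.1, h1.2, h2.1, h2.2]
    _ = d := by simp

theorem integral_integral_le_of_lintegral_le {X Y : Type*} [MeasurableSpace X] [MeasurableSpace Y]
    {μ : Measure X} {ν : Measure Y} [SFinite ν] {h : X → Y → ℝ}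
    (hm : Measurable (Function.uncurry h)) (h0 : ∀ x y, 0 ≤ h x y) {R : ℝ} (hR : 0 ≤ R)
    (hle : ∫⁻ x, ∫⁻ y, ENNReal.ofReal (h x y) ∂ν ∂μ ≤ ENNReal.ofReal R) :
    ∫ x, ∫ y, h x y ∂ν ∂μ ≤ R := by
  rw [integral_eq_lintegral_of_nonneg_ae
    (.of_forall fun x => integral_nonneg (h0 x))
    (hm.stronglyMeasurable.integral_prod_right (ν := ν)).aestronglyMeasurable]
  refine ENNReal.toReal_le_of_le_ofReal hR (le_trans (lintegral_mono fun x => ?_) hle)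
  rw [integral_eq_lintegral_of_nonneg_ae (.of_forall (h0 x))
    (hm.comp measurable_prodMk_left).aestronglyMeasurable]
  exact ENNReal.ofReal_toReal_le

theorem mul_two_pow_le_three_pow (m : ℕ) : m * 2 ^ m ≤ 3 ^ m := by
  rcases lt_or_ge m 2 with h | h
  · interval_cases m <;> norm_num
  induction m, h using Nat.le_induction with
  | base => norm_num
  | succ m hm ih =>
    rw [pow_succ, pow_succ]; nlinarith [pow_pos (by norm_num : 0 < 2) m]

theorem balanced_sum_le {d n : ℕ} (hd : 1 ≤ d) (hn : 1 ≤ n) :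
    ∃ b : ℝ, 0 < b ∧ b + (1 / b) ^ d / (n * Real.exp 1) ≤
      3 / 2 / (n : ℝ) ^ ((1 : ℝ) / (d + 1)) := by
  have hd0 : (0 : ℝ) < d := by exact_mod_cast hd
  have hn0 : (0 : ℝ) < n := by exact_mod_cast hn
  have hne : (0 : ℝ) < n * Real.exp 1 := by positivity
  set b : ℝ := (d / (n * Real.exp 1)) ^ (((d + 1 : ℕ) : ℝ)⁻¹) with hb
  have hb0 : 0 < b := by positivity
  have hbp : b ^ (d + 1) = d / (n * Real.exp 1) :=
    Real.rpow_inv_natCast_pow (by positivity) (by omega)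
  set N : ℝ := (n : ℝ) ^ ((1 : ℝ) / (d + 1)) with hN
  have hN0 : 0 < N := by positivity
  have hNp : N ^ (d + 1) = n := by
    rw [hN, one_div, show ((d : ℝ) + 1) = ((d + 1 : ℕ) : ℝ) by push_cast; ring]
    exact Real.rpow_inv_natCast_pow hn0.le (by omega)
  refine ⟨b, hb0, ?_⟩
  have h1 : b + (1 / b) ^ d / (n * Real.exp 1) = b * (1 + 1 / d) := by
    have : (1 / b) ^ d / (n * Real.exp 1) = b / d := by
      rw [pow_succ, eq_div_iff hne.ne'] at hbp
      rw [one_div, inv_pow, div_eq_div_iff hne.ne' hd0.ne', ← hbp]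
      field_simp
    rw [this]; ring
  rw [h1, le_div_iff₀ hN0]
  refine le_of_pow_le_pow_left₀ (n := d + 1) (by omega) (by norm_num) ?_
  rw [mul_pow, mul_pow, hbp, hNp]
  have h2 : (1 + 1 / (d : ℝ)) ^ d ≤ Real.exp 1 := by
    calc (1 + 1 / (d : ℝ)) ^ d ≤ Real.exp (1 / d) ^ d := by
          gcongr; linarith [Real.add_one_le_exp (1 / (d : ℝ))]
      _ = Real.exp 1 := by rw [← Real.exp_nat_mul]; congr 1; field_simp
  have h3 : ((d : ℝ) + 1) ≤ (3 / 2) ^ (d + 1) := by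
    rw [div_pow, le_div_iff₀ (by positivity)]
    exact_mod_cast mul_two_pow_le_three_pow (d + 1)
  calc d / (n * Real.exp 1) * (1 + 1 / (d : ℝ)) ^ (d + 1) * n
      = (d + 1) * ((1 + 1 / (d : ℝ)) ^ d / Real.exp 1) := by
        rw [pow_succ]; field_simp
    _ ≤ (d + 1) * 1 := by
        gcongr
        exact (div_le_one (Real.exp_pos 1)).2 h2
    _ ≤ _ := by linarith

theorem expected_nn_distance_bound (d n : ℕ) (hd : 1 ≤ d) (hn : 1 ≤ n)
    (μ : Measure (EuclideanSpace ℝ (Fin d))) [IsProbabilityMeasure μ]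
    (hsupp : ∀ᵐ x ∂μ, ∀ i, x i ∈ Set.Icc (0:ℝ) 1)
    (nn : EuclideanSpace ℝ (Fin d) → (Fin n → EuclideanSpace ℝ (Fin d)) →
      EuclideanSpace ℝ (Fin d))
    (hnn_meas : Measurable (Function.uncurry nn))
    (hnn_mem : ∀ x S, ∃ i, nn x S = S i)
    (hnn_min : ∀ x S i, ‖x - nn x S‖ ≤ ‖x - S i‖) :
    (∀ b : ℝ, 0 < b →
      (∫ x, ∫ S, ‖x - nn x S‖ ∂(Measure.pi fun _ : Fin n => μ) ∂μ) ≤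
        Real.sqrt d * (b + (1/b)^d / (n * Real.exp 1))) ∧
    (∫ x, ∫ S, ‖x - nn x S‖ ∂(Measure.pi fun _ : Fin n => μ) ∂μ) ≤
      (3/2) * Real.sqrt d / (n : ℝ) ^ ((1:ℝ) / (d + 1)) := by
  have hd0 : (0 : ℝ) < d := by exact_mod_cast hd
  have hn0 : (0 : ℝ) < n := by exact_mod_cast hn
  have hsd : 0 < √(d : ℝ) := Real.sqrt_pos.2 hd0
  have hmeas : Measurable (Function.uncurry fun x S => ‖x - nn x S‖) :=
    (measurable_fst.sub hnn_meas).norm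
  set f : EuclideanSpace ℝ (Fin d) → (Fin n → EuclideanSpace ℝ (Fin d)) → ℝ≥0∞ :=
    fun x S => ENNReal.ofReal (min √d ‖x - nn x S‖) with hf
  have hfm : Measurable (Function.uncurry f) := (measurable_const.min hmeas).ennreal_ofReal
  have hfM : ∀ x S, f x S ≤ ENNReal.ofReal √d := fun x S =>
    ENNReal.ofReal_le_ofReal (min_le_left _ _)
  have heq : ∫⁻ x, ∫⁻ S, ENNReal.ofReal ‖x - nn x S‖ ∂(Measure.pi fun _ : Fin n => μ) ∂μ =
      ∫⁻ x, ∫⁻ S, f x S ∂(Measure.pi fun _ : Fin n => μ) ∂μ := by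
    refine lintegral_congr_ae ?_
    filter_upwards [hsupp] with x hx
    refine lintegral_congr_ae ?_
    have hS := (Measure.quasiMeasurePreserving_eval (fun _ : Fin n => μ) ⟨0, hn⟩).ae hsupp
    filter_upwards [hS] with S hS
    rw [hf]
    simp only
    rw [min_eq_right ((hnn_min x S ⟨0, hn⟩).trans (norm_sub_le_sqrt_of_mem_cube hx hS))]
  have hmain : ∀ b : ℝ, 0 < b →
      (∫ x, ∫ S, ‖x - nn x S‖ ∂(Measure.pi fun _ : Fin n => μ) ∂μ) ≤
        √d * (b + (1 / b) ^ d / (n * Real.exp 1)) := by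
    intro b hb
    refine integral_integral_le_of_lintegral_le hmeas (fun _ _ => norm_nonneg _)
      (by positivity) ?_
    rw [heq]
    rcases le_or_gt 1 b with hb1 | hb1
    · calc _ ≤ ∫⁻ _, ∫⁻ _, ENNReal.ofReal √d ∂(Measure.pi fun _ : Fin n => μ) ∂μ :=
            lintegral_mono fun x => lintegral_mono fun S => hfM x S
        _ = ENNReal.ofReal √d := by simp
        _ ≤ _ := by
            refine ENNReal.ofReal_le_ofReal ?_
            have : 0 ≤ (1 / b) ^ d / (n * Real.exp 1) := by positivity
            nlinarith
    obtain ⟨k, j, hk, hj, s, hs0, hs1, hsb, hs, hN⟩ :=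
      exists_grid hd (B := 1 / b) ((one_le_div hb).2 hb1.le)
    set κ : Fin d → ℕ := fun i => if (i : ℕ) < j then k + 1 else k with hκ
    obtain ⟨φ, c, hφ, hc⟩ := exists_cube_partition κ fun i => by simp only [hκ]; split_ifs <;> omega
    have hcard1 : (Finset.univ.filter fun i : Fin d => (i : ℕ) < j).card = j := by
      rw [Fin.card_filter_val_lt]; omega
    have hcard2 : (Finset.univ.filter fun i : Fin d => ¬ (i : ℕ) < j).card = d - j := by
      have := Finset.card_filter_add_card_filter_not (s := (Finset.univ : Finset (Fin d)))
        (fun i : Fin d => (i : ℕ) < j)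
      simp only [Finset.card_univ, Fintype.card_fin] at this
      omega
    have hprod : (Fintype.card (∀ i, Fin (κ i)) : ℝ) = ((k : ℝ) + 1) ^ j * (k : ℝ) ^ (d - j) := by
      simp only [Fintype.card_pi, Fintype.card_fin, hκ]
      rw [Finset.prod_ite, Finset.prod_const, Finset.prod_const, hcard1, hcard2]
      push_cast
      ring
    have hsum : ∑ i, 1 / (κ i : ℝ) ^ 2 = 2 * d * s ^ 2 := by
      rw [hs]
      simp only [hκ, Nat.cast_ite, apply_ite (fun t : ℝ => 1 / t ^ 2)]
      rw [Finset.sum_ite, Finset.sum_const, Finset.sum_const, hcard1, hcard2, nsmul_eq_mul,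
        nsmul_eq_mul, Nat.cast_sub hj]
      push_cast
      ring
    have hae : ∀ᵐ x ∂μ, ‖x - c (φ x)‖ ^ 2 ≤ (√d * s) ^ 2 / 2 := by
      filter_upwards [hsupp] with x hx
      refine (hc x hx).trans (le_of_eq ?_)
      rw [hsum, mul_pow, Real.sq_sqrt hd0.le]
      ring
    refine (lintegral_lintegral_le_of_partition μ hφ c (by positivity) (M := √d) (by nlinarith)
      hae hn f hfm hfM fun x S i => ENNReal.ofReal_le_ofReal
        ((min_le_right _ _).trans (hnn_min x S i))).trans (ENNReal.ofReal_le_ofReal ?_)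
    rw [hprod]
    have hsb' : s ≤ b := by
      rwa [mul_one_div, div_le_one hb] at hsb
    calc √d * s + (√d - √d * s) * (((k : ℝ) + 1) ^ j * (k : ℝ) ^ (d - j) / (n * Real.exp 1))
        = √d * (s + (1 - s) * (((k : ℝ) + 1) ^ j * (k : ℝ) ^ (d - j)) / (n * Real.exp 1)) := by
          ring
      _ ≤ _ := by gcongr
  refine ⟨hmain, ?_⟩
  obtain ⟨b, hb, hle⟩ := balanced_sum_le hd hn
  calc _ ≤ √d * (b + (1 / b) ^ d / (n * Real.exp 1)) := hmain b hb
    _ ≤ √d * (3 / 2 / (n : ℝ) ^ ((1 : ℝ) / (d + 1))) := by gcongr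
    _ = _ := by ring
end

section
/- Under symmetric noise τ₋ = τ₊ = τ ∈ [0,1/2), the expected error of the 1-nearest-neighbor classifier trained on the corrupted sample satisfies τ + (1-2τ)(R* - (3L√d)/(2n^{1/(d+1)})) ≤ E[R_D(h¹)] ≤ τ + (1-2τ)(2R* + (3L√d)/(2n^{1/(d+1)})), where R* is the Bayes error. -/
open MeasureTheory

namespace NearestNeighbor

lemma one_sub_pow_mul_le {n : ℕ} (hn : 1 ≤ n) {q : ℝ} (hq1 : q ≤ 1) (hq0 : 0 ≤ q) :
    (1 - q) ^ n * q ≤ 37 / 100 / n := by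
  have hn' : (0 : ℝ) < n := by exact_mod_cast hn
  have h1 : (1 - q) ^ n ≤ Real.exp (-(n * q)) := by
    rw [show -(n * q) = (n : ℝ) * (-q) by ring, Real.exp_nat_mul]
    exact pow_le_pow_left₀ (by linarith) (Real.one_sub_le_exp_neg q) n
  have h2 : n * q ≤ Real.exp (n * q - 1) := by linarith [Real.add_one_le_exp (n * q - 1)]
  have h3 : Real.exp (-(n * q)) * Real.exp (n * q - 1) ≤ 37 / 100 := by
    rw [← Real.exp_add, show -(n * q) + (n * q - 1) = (-1 : ℝ) by ring, Real.exp_neg]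
    rw [inv_le_comm₀ (Real.exp_pos 1) (by norm_num)]
    linarith [Real.exp_one_gt_d9]
  rw [le_div_iff₀ hn']
  calc (1 - q) ^ n * q * n = (1 - q) ^ n * (n * q) := by ring
    _ ≤ Real.exp (-(n * q)) * Real.exp (n * q - 1) := by gcongr
    _ ≤ _ := h3

section Missed

variable {E ι : Type*}

/-- Pairs of a query point and a sample such that no sample point has the label of the query. -/
def missed (f : E → ι) (n : ℕ) : Set (E × (Fin n → E)) :=
  {z | ∀ i, f (z.2 i) ≠ f z.1}

variable [MeasurableSpace E] [Fintype ι] [MeasurableSpace ι] [MeasurableSingletonClass ι]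

lemma measurableSet_missed {f : E → ι} (hf : Measurable f) (n : ℕ) :
    MeasurableSet (missed f n) := by
  have : missed f n = ⋂ i, {z : E × (Fin n → E) | f (z.2 i) = f z.1}ᶜ := by
    ext z; simp [missed]
  rw [this]
  refine MeasurableSet.iInter fun i => MeasurableSet.compl ?_
  exact measurableSet_eq_fun (hf.comp ((measurable_pi_apply i).comp measurable_snd))
    (hf.comp measurable_fst)

lemma measureReal_missed_le (μ : Measure E) [IsProbabilityMeasure μ] {f : E → ι}
    (hf : Measurable f) {n : ℕ} (hn : 1 ≤ n) :
    (μ.prod (Measure.pi fun _ : Fin n => μ)).real (missed f n)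
      ≤ Fintype.card ι * (37 / 100 / n) := by
  have hslice : ∀ x, (Measure.pi fun _ : Fin n => μ) (Prod.mk x ⁻¹' missed f n)
      = (fun c => μ (f ⁻¹' {c})ᶜ ^ n) (f x) := by
    intro x
    have : Prod.mk x ⁻¹' missed f n = Set.pi Set.univ fun _ : Fin n => (f ⁻¹' {f x})ᶜ := by
      ext S; simp [missed]
    rw [this, Measure.pi_pi]
    simp
  have key : (μ.prod (Measure.pi fun _ : Fin n => μ)) (missed f n)
      ≤ ENNReal.ofReal (Fintype.card ι * (37 / 100 / n)) := by
    rw [Measure.prod_apply (measurableSet_missed hf n)]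
    simp_rw [hslice]
    rw [← lintegral_map (f := fun c => μ (f ⁻¹' {c})ᶜ ^ n) (Measurable.of_discrete) hf,
      lintegral_fintype]
    calc _ ≤ ∑ _c : ι, ENNReal.ofReal (37 / 100 / n) := by
          refine Finset.sum_le_sum fun c _ => ?_
          have hm : MeasurableSet (f ⁻¹' {c}) := hf (measurableSet_singleton c)
          rw [Measure.map_apply hf (measurableSet_singleton c),
            ← ofReal_measureReal (μ := μ) (s := (f ⁻¹' {c})ᶜ),
            ← ofReal_measureReal (μ := μ) (s := f ⁻¹' {c}),
            probReal_compl_eq_one_sub hm, ← ENNReal.ofReal_pow (by simp [measureReal_le_one]),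
            ← ENNReal.ofReal_mul (by have : μ.real (f ⁻¹' {c}) ≤ 1 := measureReal_le_one
                                     exact pow_nonneg (by linarith) _)]
          exact ENNReal.ofReal_le_ofReal
            (one_sub_pow_mul_le hn measureReal_le_one measureReal_nonneg)
      _ = _ := by
          rw [Finset.sum_const, Finset.card_univ, nsmul_eq_mul, ENNReal.ofReal_mul (by positivity)]
          simp
  exact ENNReal.toReal_le_of_le_ofReal (by positivity) key

end Missed

section Grid

variable {d : ℕ}

/-- The cell of the grid dividing the `i`-th axis of the unit cube into `k i + 1` parts. -/
noncomputable def gridCell (k : Fin d → ℕ) (x : EuclideanSpace ℝ (Fin d)) (i : Fin d) :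
    Fin (k i + 1) :=
  ⟨min ⌊(k i + 1) * x i⌋₊ (k i), by omega⟩

lemma measurable_gridCell (k : Fin d → ℕ) : Measurable (gridCell k) := by
  refine measurable_pi_lambda _ fun i => ?_
  have h : Measurable fun x : EuclideanSpace ℝ (Fin d) => ⌊((k i : ℝ) + 1) * x i⌋₊ :=
    Nat.measurable_floor.comp (by fun_prop)
  exact (Measurable.of_discrete (f := fun m : ℕ => (⟨min m (k i), by omega⟩ : Fin (k i + 1)))).comp h

lemma abs_sub_le_of_floor_eq {k : ℕ} {a b : ℝ} (ha : a ∈ Set.Icc (0 : ℝ) 1)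
    (hb : b ∈ Set.Icc (0 : ℝ) 1)
    (h : min ⌊(k + 1) * a⌋₊ k = min ⌊(k + 1) * b⌋₊ k) :
    |a - b| ≤ 1 / (k + 1) := by
  have hk : (0 : ℝ) < k + 1 := by positivity
  have aux : ∀ x ∈ Set.Icc (0 : ℝ) 1,
      ((min ⌊(k + 1) * x⌋₊ k : ℕ) : ℝ) ≤ (k + 1) * x ∧
        (k + 1) * x ≤ ((min ⌊(k + 1) * x⌋₊ k : ℕ) : ℝ) + 1 := by
    intro x hx
    have h0 : 0 ≤ (k + 1) * x := mul_nonneg hk.le hx.1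
    have h1 := Nat.floor_le h0
    have h2 := Nat.lt_floor_add_one ((k + 1) * x)
    have h3 : (k + 1) * x ≤ k + 1 := by nlinarith [hx.2]
    push_cast
    refine ⟨(min_le_left _ _).trans h1, ?_⟩
    rw [← min_add_add_right]
    exact le_min h2.le h3
  have h1 := aux a ha
  have h2 := aux b hb
  rw [h] at h1
  rw [abs_le, neg_le, le_div_iff₀ hk, le_div_iff₀ hk]
  constructor <;> linarith

lemma norm_sub_sq_le_of_gridCell_eq {k : Fin d → ℕ} {x y : EuclideanSpace ℝ (Fin d)}
    (hx : ∀ i, x i ∈ Set.Icc (0 : ℝ) 1) (hy : ∀ i, y i ∈ Set.Icc (0 : ℝ) 1)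
    (h : gridCell k y = gridCell k x) :
    ‖x - y‖ ^ 2 ≤ ∑ i, (1 / ((k i : ℝ) + 1)) ^ 2 := by
  rw [EuclideanSpace.norm_sq_eq]
  refine Finset.sum_le_sum fun i _ => ?_
  have hi := congrArg Fin.val (congrFun h i)
  simp only [gridCell] at hi
  have := abs_sub_le_of_floor_eq (hx i) (hy i) hi.symm
  rw [PiLp.sub_apply, Real.norm_eq_abs]
  gcongr

lemma norm_sub_sq_le_card {x y : EuclideanSpace ℝ (Fin d)}
    (hx : ∀ i, x i ∈ Set.Icc (0 : ℝ) 1) (hy : ∀ i, y i ∈ Set.Icc (0 : ℝ) 1) :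
    ‖x - y‖ ^ 2 ≤ d := by
  have := norm_sub_sq_le_of_gridCell_eq (k := fun _ => 0) hx hy
    (funext fun _ => Fin.ext (by simp [gridCell]))
  simpa using this

lemma measureReal_missed_gridCell_le (μ : Measure (EuclideanSpace ℝ (Fin d)))
    [IsProbabilityMeasure μ] (k : Fin d → ℕ) {n : ℕ} (hn : 1 ≤ n) :
    (μ.prod (Measure.pi fun _ : Fin n => μ)).real (missed (gridCell k) n)
      ≤ (∏ i, ((k i : ℝ) + 1)) * (37 / 100 / n) := by
  have := measureReal_missed_le μ (measurable_gridCell k) hn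
  simpa [Fintype.card_pi] using this

lemma integrable_indicator_missed (μ : Measure (EuclideanSpace ℝ (Fin d)))
    [IsProbabilityMeasure μ] (k : Fin d → ℕ) (n : ℕ) :
    Integrable ((missed (gridCell k) n).indicator fun _ => (1 : ℝ))
      (μ.prod (Measure.pi fun _ : Fin n => μ)) :=
  (integrable_const 1).indicator (measurableSet_missed (measurable_gridCell k) n)

lemma integral_indicator_missed (μ : Measure (EuclideanSpace ℝ (Fin d)))
    [IsProbabilityMeasure μ] (k : Fin d → ℕ) (n : ℕ) :
    ∫ z, (missed (gridCell k) n).indicator (fun _ => (1 : ℝ)) z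
      ∂(μ.prod (Measure.pi fun _ : Fin n => μ)) =
      (μ.prod (Measure.pi fun _ : Fin n => μ)).real (missed (gridCell k) n) :=
  integral_indicator_one (measurableSet_missed (measurable_gridCell k) n)

end Grid

section Distance

variable {d n : ℕ}

lemma ae_mem_cube {μ : Measure (EuclideanSpace ℝ (Fin d))} [IsProbabilityMeasure μ]
    (hsupp : ∀ᵐ x ∂μ, ∀ i, x i ∈ Set.Icc (0 : ℝ) 1) :
    ∀ᵐ z ∂(μ.prod (Measure.pi fun _ : Fin n => μ)),
      (∀ i, z.1 i ∈ Set.Icc (0 : ℝ) 1) ∧ ∀ j i, z.2 j i ∈ Set.Icc (0 : ℝ) 1 := by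
  have h1 : ∀ᵐ z ∂(μ.prod (Measure.pi fun _ : Fin n => μ)), ∀ i, z.1 i ∈ Set.Icc (0 : ℝ) 1 :=
    Measure.quasiMeasurePreserving_fst.ae hsupp
  have h2 : ∀ᵐ z ∂(μ.prod (Measure.pi fun _ : Fin n => μ)),
      ∀ j i, z.2 j i ∈ Set.Icc (0 : ℝ) 1 := by
    refine Measure.quasiMeasurePreserving_snd.ae 
      (p := fun S : Fin n → EuclideanSpace ℝ (Fin d) => ∀ j i, S j i ∈ Set.Icc (0 : ℝ) 1) ?_
    rw [ae_all_iff]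
    exact fun j => (measurePreserving_eval (fun _ : Fin n => μ) j).quasiMeasurePreserving.ae hsupp
  exact h1.and h2

variable {nn : EuclideanSpace ℝ (Fin d) → (Fin n → EuclideanSpace ℝ (Fin d)) →
      EuclideanSpace ℝ (Fin d)}

lemma norm_sub_nn_sq_le_card (hnn_mem : ∀ x S, ∃ i, nn x S = S i)
    {z : EuclideanSpace ℝ (Fin d) × (Fin n → EuclideanSpace ℝ (Fin d))}
    (hz : (∀ i, z.1 i ∈ Set.Icc (0 : ℝ) 1) ∧ ∀ j i, z.2 j i ∈ Set.Icc (0 : ℝ) 1) :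
    ‖z.1 - nn z.1 z.2‖ ^ 2 ≤ d := by
  obtain ⟨j, hj⟩ := hnn_mem z.1 z.2
  rw [hj]
  exact norm_sub_sq_le_card hz.1 (hz.2 j)

lemma norm_sub_nn_sq_le_of_notMem_missed
    (hnn_min : ∀ x S i, ‖x - nn x S‖ ≤ ‖x - S i‖) {k : Fin d → ℕ}
    {z : EuclideanSpace ℝ (Fin d) × (Fin n → EuclideanSpace ℝ (Fin d))}
    (hz : (∀ i, z.1 i ∈ Set.Icc (0 : ℝ) 1) ∧ ∀ j i, z.2 j i ∈ Set.Icc (0 : ℝ) 1)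
    (h : z ∉ missed (gridCell k) n) :
    ‖z.1 - nn z.1 z.2‖ ^ 2 ≤ ∑ i, (1 / ((k i : ℝ) + 1)) ^ 2 := by
  simp only [missed, Set.mem_ofPred_eq, not_forall, not_not] at h
  obtain ⟨j, hj⟩ := h
  calc _ ≤ ‖z.1 - z.2 j‖ ^ 2 := by gcongr; exact hnn_min _ _ _
    _ ≤ _ := norm_sub_sq_le_of_gridCell_eq hz.1 (hz.2 j) hj

variable {μ : Measure (EuclideanSpace ℝ (Fin d))} [IsProbabilityMeasure μ]

lemma integrable_norm_sub_nn_pow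
    (hsupp : ∀ᵐ x ∂μ, ∀ i, x i ∈ Set.Icc (0 : ℝ) 1)
    (hnn_meas : Measurable (Function.uncurry nn))
    (hnn_mem : ∀ x S, ∃ i, nn x S = S i) (m : ℕ) :
    Integrable (fun z : EuclideanSpace ℝ (Fin d) × (Fin n → EuclideanSpace ℝ (Fin d)) =>
      ‖z.1 - nn z.1 z.2‖ ^ m) (μ.prod (Measure.pi fun _ : Fin n => μ)) := by
  refine Integrable.of_bound (C := Real.sqrt d ^ m) ?_ ?_
  · exact ((measurable_fst.sub hnn_meas).norm.pow_const m).aestronglyMeasurable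
  · filter_upwards [ae_mem_cube (n := n) hsupp] with z hz
    rw [Real.norm_of_nonneg (by positivity)]
    gcongr
    exact Real.le_sqrt_of_sq_le (norm_sub_nn_sq_le_card hnn_mem hz)

lemma integral_norm_sub_nn_le_uniform (hn : 1 ≤ n)
    (hsupp : ∀ᵐ x ∂μ, ∀ i, x i ∈ Set.Icc (0 : ℝ) 1)
    (hnn_meas : Measurable (Function.uncurry nn))
    (hnn_mem : ∀ x S, ∃ i, nn x S = S i)
    (hnn_min : ∀ x S i, ‖x - nn x S‖ ≤ ‖x - S i‖) {T : ℕ} (hT : 1 ≤ T) :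
    ∫ z, ‖z.1 - nn z.1 z.2‖ ∂(μ.prod (Measure.pi fun _ : Fin n => μ)) ≤
      Real.sqrt d * (1 / T + (1 - 1 / T) * ((T : ℝ) ^ d * (37 / 100 / n))) := by
  obtain ⟨k, rfl⟩ := Nat.exists_eq_add_of_le' hT
  have hk : (1 : ℝ) / (k + 1 : ℕ) ≤ 1 := by
    rw [div_le_one (by positivity)]; exact_mod_cast hT
  have hint := integrable_norm_sub_nn_pow (n := n) hsupp hnn_meas hnn_mem 1
  simp only [pow_one] at hint
  have hpt : ∀ᵐ z ∂(μ.prod (Measure.pi fun _ : Fin n => μ)), ‖z.1 - nn z.1 z.2‖ ≤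
      Real.sqrt d * (1 / (k + 1 : ℕ)) + Real.sqrt d * (1 - 1 / (k + 1 : ℕ)) *
        (missed (gridCell fun _ : Fin d => k) n).indicator (fun _ => (1 : ℝ)) z := by
    filter_upwards [ae_mem_cube (n := n) hsupp] with z hz
    by_cases h : z ∈ missed (gridCell fun _ : Fin d => k) n
    · rw [Set.indicator_of_mem h]
      have := Real.le_sqrt_of_sq_le (norm_sub_nn_sq_le_card hnn_mem hz)
      linarith
    · rw [Set.indicator_of_notMem h]
      have h2 := norm_sub_nn_sq_le_of_notMem_missed hnn_min hz h
      refine abs_le_of_sq_le_sq' ?_ (by positivity) |>.2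
      rw [mul_zero, add_zero, mul_pow, Real.sq_sqrt (by positivity)]
      simpa using h2
  have hmiss := measureReal_missed_gridCell_le μ (fun _ : Fin d => k) hn
  calc _ ≤ _ := integral_mono_ae hint
        ((integrable_const _).add ((integrable_indicator_missed μ _ n).const_mul _)) hpt
    _ = Real.sqrt d * (1 / (k + 1 : ℕ)) + Real.sqrt d * (1 - 1 / (k + 1 : ℕ)) *
        (μ.prod (Measure.pi fun _ : Fin n => μ)).real
          (missed (gridCell fun _ : Fin d => k) n) := by
        simp only [Pi.add_apply]
        rw [integral_add (integrable_const _) ((integrable_indicator_missed μ _ n).const_mul _),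
          integral_const_mul (Real.sqrt d * (1 - 1 / (k + 1 : ℕ))), integral_indicator_missed]
        simp
    _ ≤ Real.sqrt d * (1 / (k + 1 : ℕ)) + Real.sqrt d * (1 - 1 / (k + 1 : ℕ)) *
        (((k + 1 : ℕ) : ℝ) ^ d * (37 / 100 / n)) := by
        have h0 : 0 ≤ Real.sqrt d * (1 - 1 / (k + 1 : ℕ)) :=
          mul_nonneg (Real.sqrt_nonneg _) (by linarith)
        gcongr
        simpa using hmiss
    _ = _ := by ring

/-- Halving only the first `j` axes. -/
def halving (d j : ℕ) (i : Fin d) : ℕ := if i.val < j then 1 else 0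

lemma sum_ite_val_lt {a : ℕ} (ha : a ≤ d) :
    ∑ i : Fin d, (if i.val < a then (1 : ℝ) else 0) = a := by
  rw [Fin.sum_univ_eq_sum_range (fun i => if i < a then (1 : ℝ) else 0) d, Finset.sum_ite]
  have : (Finset.range d).filter (fun i => i < a) = Finset.range a := by
    ext i; simp; omega
  simp [this]

lemma sum_halving {a : ℕ} (ha : a ≤ d) :
    ∑ i, (1 / ((halving d a i : ℝ) + 1)) ^ 2 = (d : ℝ) - 3 / 4 * a := by
  have : ∀ i, (1 / ((halving d a i : ℝ) + 1)) ^ 2 =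
      1 - 3 / 4 * (if i.val < a then (1 : ℝ) else 0) := by
    intro i; unfold halving; split_ifs <;> norm_num
  simp_rw [this, Finset.sum_sub_distrib, ← Finset.mul_sum, sum_ite_val_lt ha]
  simp

lemma prod_halving {a : ℕ} (ha : a ≤ d) :
    ∏ i, ((halving d a i : ℝ) + 1) = 2 ^ a := by
  have : ∀ i, ((halving d a i : ℝ) + 1) = if i.val < a then (2 : ℝ) else 1 := by
    intro i; unfold halving; split_ifs <;> norm_num
  simp_rw [this]
  rw [Fin.prod_univ_eq_prod_range (fun i => if i < a then (2 : ℝ) else 1) d, Finset.prod_ite]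
  have : (Finset.range d).filter (fun i => i < a) = Finset.range a := by
    ext i; simp; omega
  simp [this]

lemma norm_sub_nn_sq_le_halving (hnn_mem : ∀ x S, ∃ i, nn x S = S i)
    (hnn_min : ∀ x S i, ‖x - nn x S‖ ≤ ‖x - S i‖)
    {z : EuclideanSpace ℝ (Fin d) × (Fin n → EuclideanSpace ℝ (Fin d))}
    (hz : (∀ i, z.1 i ∈ Set.Icc (0 : ℝ) 1) ∧ ∀ j i, z.2 j i ∈ Set.Icc (0 : ℝ) 1)
    {a : ℕ} (ha : a ≤ d) :
    ‖z.1 - nn z.1 z.2‖ ^ 2 ≤ d - 3 / 4 * a + 3 / 4 * ∑ j ∈ Finset.range a,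
      (missed (gridCell (halving d (j + 1))) n).indicator (fun _ => (1 : ℝ)) z := by
  induction a with
  | zero => simpa using norm_sub_nn_sq_le_card hnn_mem hz
  | succ a ih =>
    by_cases h : z ∈ missed (gridCell (halving d (a + 1))) n
    · rw [Finset.sum_range_succ, Set.indicator_of_mem h]
      push_cast
      linarith [ih (by omega)]
    · have h1 := norm_sub_nn_sq_le_of_notMem_missed hnn_min hz h
      rw [sum_halving ha] at h1
      have h2 : 0 ≤ ∑ j ∈ Finset.range (a + 1),
          (missed (gridCell (halving d (j + 1))) n).indicator (fun _ => (1 : ℝ)) z :=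
        Finset.sum_nonneg fun j _ => Set.indicator_nonneg (fun _ _ => zero_le_one) _
      linarith

lemma integral_norm_sub_nn_sq_le_halving (hn : 1 ≤ n)
    (hsupp : ∀ᵐ x ∂μ, ∀ i, x i ∈ Set.Icc (0 : ℝ) 1)
    (hnn_meas : Measurable (Function.uncurry nn))
    (hnn_mem : ∀ x S, ∃ i, nn x S = S i)
    (hnn_min : ∀ x S i, ‖x - nn x S‖ ≤ ‖x - S i‖) {a : ℕ} (ha : a ≤ d) :
    ∫ z, ‖z.1 - nn z.1 z.2‖ ^ 2 ∂(μ.prod (Measure.pi fun _ : Fin n => μ)) ≤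
      d - 3 / 4 * a + 3 / 2 * (2 ^ a * (37 / 100 / n)) := by
  have hsum := integrable_finsetSum (μ := μ.prod (Measure.pi fun _ : Fin n => μ))
    (Finset.range a) (f := fun j => (missed (gridCell (halving d (j + 1))) n).indicator
      (fun _ => (1 : ℝ))) fun j _ => integrable_indicator_missed μ _ n
  have hgeom : ∑ j ∈ Finset.range a, (2 : ℝ) ^ (j + 1) ≤ 2 * 2 ^ a := by
    simp_rw [pow_succ]
    rw [← Finset.sum_mul, geom_sum_eq (by norm_num)]
    norm_num
    linarith
  calc _ ≤ _ := integral_mono_ae (integrable_norm_sub_nn_pow hsupp hnn_meas hnn_mem 2)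
        ((integrable_const _).add (hsum.const_mul _))
        ((ae_mem_cube (n := n) hsupp).mono fun z hz =>
          norm_sub_nn_sq_le_halving hnn_mem hnn_min hz ha)
    _ = d - 3 / 4 * a + 3 / 4 * ∑ j ∈ Finset.range a,
        (μ.prod (Measure.pi fun _ : Fin n => μ)).real
          (missed (gridCell (halving d (j + 1))) n) := by
        simp only [Pi.add_apply]
        rw [integral_add (integrable_const _) (hsum.const_mul _), integral_const_mul,
          integral_finsetSum _ fun j _ => integrable_indicator_missed μ _ n]
        simp_rw [integral_indicator_missed]
        simp
    _ ≤ d - 3 / 4 * a + 3 / 4 * ∑ j ∈ Finset.range a, 2 ^ (j + 1) * (37 / 100 / (n : ℝ)) := by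
        gcongr with j hj
        rw [← prod_halving (d := d) (a := j + 1) (by have := Finset.mem_range.1 hj; omega)]
        exact measureReal_missed_gridCell_le μ _ hn
    _ ≤ d - 3 / 4 * a + 3 / 4 * ((2 * 2 ^ a) * (37 / 100 / (n : ℝ))) := by
        rw [← Finset.sum_mul]
        gcongr
    _ = _ := by ring

lemma integral_norm_sub_nn_le_of_sq_le
    (hsupp : ∀ᵐ x ∂μ, ∀ i, x i ∈ Set.Icc (0 : ℝ) 1)
    (hnn_meas : Measurable (Function.uncurry nn))
    (hnn_mem : ∀ x S, ∃ i, nn x S = S i) {B : ℝ} (hB : 0 < B)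
    (h : ∫ z, ‖z.1 - nn z.1 z.2‖ ^ 2 ∂(μ.prod (Measure.pi fun _ : Fin n => μ)) ≤ B ^ 2) :
    ∫ z, ‖z.1 - nn z.1 z.2‖ ∂(μ.prod (Measure.pi fun _ : Fin n => μ)) ≤ B := by
  have hint := integrable_norm_sub_nn_pow (n := n) hsupp hnn_meas hnn_mem 1
  have hint2 := integrable_norm_sub_nn_pow (n := n) hsupp hnn_meas hnn_mem 2
  simp only [pow_one] at hint
  have h1 : ∫ z, 2 * B * ‖z.1 - nn z.1 z.2‖ ∂(μ.prod (Measure.pi fun _ : Fin n => μ)) ≤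
      ∫ z, (‖z.1 - nn z.1 z.2‖ ^ 2 + B ^ 2) ∂(μ.prod (Measure.pi fun _ : Fin n => μ)) := by
    refine integral_mono (hint.const_mul _) (hint2.add (integrable_const _)) fun z => ?_
    nlinarith [sq_nonneg (‖z.1 - nn z.1 z.2‖ - B)]
  rw [integral_const_mul, integral_add hint2 (integrable_const _)] at h1
  simp only [integral_const, probReal_univ, one_smul] at h1
  nlinarith

end Distance

section Numeric

/-- The grid with `T` parts per axis is fine enough at sample size `t ^ (d + 1)`. -/
def GridSuffices (d : ℕ) (t : ℝ) (T : ℕ) : Prop :=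
  t / T + (1 - 1 / T) * (37 / 100) * (T / t) ^ d ≤ 3 / 2

lemma gridSuffices_of_pow_le {d T : ℕ} {t : ℝ} (ht : 0 < t) (hT : 1 ≤ T)
    (h : t / T + 37 / 100 * (T / t) ^ d ≤ 3 / 2) : GridSuffices d t T := by
  have hT' : (0 : ℝ) < T := by exact_mod_cast hT
  have : 0 ≤ 1 / (T : ℝ) * (37 / 100 * (T / t) ^ d) := by positivity
  unfold GridSuffices
  linarith

lemma gridSuffices_of_poly {d T : ℕ} {t : ℝ} (ht : 0 < t) (hT : 1 ≤ T)
    (h : 1 + 37 / 100 * (T / t) ^ (d + 1) ≤ 3 / 2 * (T / t)) : GridSuffices d t T := by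
  have hT' : (0 : ℝ) < T := by exact_mod_cast hT
  have hx : (0 : ℝ) < T / t := by positivity
  refine gridSuffices_of_pow_le ht hT ?_
  rw [show t / T = 1 / (T / t) by field_simp, ← sub_nonneg]
  have : 3 / 2 - (1 / (T / t) + 37 / 100 * (T / t) ^ d) =
      (3 / 2 * (T / t) - (1 + 37 / 100 * (T / t) ^ (d + 1))) / (T / t) := by
    rw [pow_succ]; field_simp
  rw [this]
  exact div_nonneg (by linarith) hx.le

lemma exists_gridSuffices_one {t : ℝ} (ht : 1 ≤ t) : ∃ T, 1 ≤ T ∧ GridSuffices 1 t T := by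
  have ht0 : 0 < t := by linarith
  have h1 := Nat.le_ceil t
  have h2 := Nat.ceil_lt_add_one ht0.le
  have hT : 1 ≤ ⌈t⌉₊ := Nat.one_le_ceil_iff.2 ht0
  refine ⟨⌈t⌉₊, hT, gridSuffices_of_poly ht0 hT ?_⟩
  have hx1 : 1 ≤ (⌈t⌉₊ : ℝ) / t := by rwa [one_le_div ht0]
  have hx2 : (⌈t⌉₊ : ℝ) / t ≤ 2 := by rw [div_le_iff₀ ht0]; linarith
  nlinarith

lemma exists_gridSuffices_two {t : ℝ} (ht : 1 ≤ t) : ∃ T, 1 ≤ T ∧ GridSuffices 2 t T := by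
  have ht0 : 0 < t := by linarith
  by_cases h : t ≤ 3 / 2
  · exact ⟨1, le_rfl, by simpa [GridSuffices] using h⟩
  push Not at h
  have h1 := Nat.le_ceil t
  have h2 := Nat.ceil_lt_add_one ht0.le
  have hT : 1 ≤ ⌈t⌉₊ := Nat.one_le_ceil_iff.2 ht0
  refine ⟨⌈t⌉₊, hT, gridSuffices_of_poly ht0 hT ?_⟩
  have hx1 : 1 ≤ (⌈t⌉₊ : ℝ) / t := by rwa [one_le_div ht0]
  have hx2 : (⌈t⌉₊ : ℝ) / t ≤ 3 / 2 := by
    rw [div_le_iff₀ ht0]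
    rcases le_total t 2 with h3 | h3
    · have : (⌈t⌉₊ : ℝ) ≤ 2 := by exact_mod_cast Nat.ceil_le.2 (by exact_mod_cast h3)
      linarith
    · linarith
  set x := (⌈t⌉₊ : ℝ) / t
  nlinarith [mul_nonneg (sub_nonneg.2 hx1) (sub_nonneg.2 hx2),
    mul_nonneg (mul_nonneg (sub_nonneg.2 hx1) (sub_nonneg.2 hx2)) (by linarith : (0 : ℝ) ≤ x)]

lemma nat_mul_pow_le {d : ℕ} (hd : 3 ≤ d) : (d : ℝ) * (5 / 7) ^ d ≤ 6 / 5 := by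
  induction d, hd using Nat.le_induction with
  | base => norm_num
  | succ d hd ih =>
    have h3 : (3 : ℝ) ≤ d := by exact_mod_cast hd
    have hp : (0 : ℝ) < (5 / 7) ^ d := by positivity
    rw [pow_succ]; push_cast
    nlinarith

lemma exists_gridSuffices_of_three_le {d : ℕ} (hd : 3 ≤ d) {t : ℝ} (ht : 2 ≤ t) :
    ∃ T, 1 ≤ T ∧ GridSuffices d t T := by
  have ht0 : 0 < t := by linarith
  have hpow : ∀ x : ℝ, 0 ≤ x → x ≤ 1 → x ^ d ≤ x ^ 3 := fun x h0 h1 =>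
    pow_le_pow_of_le_one h0 h1 hd
  rcases le_or_gt 3 t with h3 | h3
  · have h1 := Nat.floor_le ht0.le
    have h2 := Nat.lt_floor_add_one t
    have hT3 : 3 ≤ ⌊t⌋₊ := Nat.le_floor (by exact_mod_cast h3)
    have hT3' : (3 : ℝ) ≤ ⌊t⌋₊ := by exact_mod_cast hT3
    refine ⟨⌊t⌋₊, by omega, gridSuffices_of_poly ht0 (by omega) ?_⟩
    have hx2 : (⌊t⌋₊ : ℝ) / t ≤ 1 := by rwa [div_le_one ht0]
    have hx1 : 3 / 4 ≤ (⌊t⌋₊ : ℝ) / t := by rw [le_div_iff₀ ht0]; linarith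
    set x := (⌊t⌋₊ : ℝ) / t
    have hx := hpow x (by linarith) hx2
    have : x ^ (d + 1) ≤ x ^ 4 := by
      rw [pow_succ, show x ^ 4 = x ^ 3 * x by ring]
      gcongr
    have hq : x ^ 4 ≤ (4 * x - 3) + (1 - x) * 4 * (81 / 256) := by
      nlinarith [mul_nonneg (sub_nonneg.2 hx1) (sub_nonneg.2 hx2),
        mul_nonneg (mul_nonneg (sub_nonneg.2 hx1) (sub_nonneg.2 hx2)) (by linarith : (0 : ℝ) ≤ x),
        mul_nonneg (mul_nonneg (sub_nonneg.2 hx1) (sub_nonneg.2 hx2)) (sq_nonneg x)]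
    linarith
  · by_cases hA : (3 / t) ^ d ≤ 4 / 3
    · refine ⟨3, by norm_num, gridSuffices_of_pow_le ht0 (by norm_num) ?_⟩
      push_cast
      linarith
    push Not at hA
    refine ⟨2, by norm_num, ?_⟩
    unfold GridSuffices
    push_cast
    have hx0 : 0 < 2 / t := by positivity
    have hx2 : 2 / t ≤ 1 := by rwa [div_le_one ht0]
    rcases le_or_gt t (14 / 5) with h5 | h5
    · have hx1 : 5 / 7 ≤ 2 / t := by rw [le_div_iff₀ ht0]; linarith
      have hx := hpow _ hx0.le hx2
      rw [show t / 2 = 1 / (2 / t) by field_simp]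
      set x := 2 / t
      have hinv : 1 / x ≤ 7 / 5 - 7 / 5 * (x - 5 / 7) := by
        rw [div_le_iff₀ hx0]
        nlinarith
      have hc : x ^ 3 ≤ 125 / 343 + (x - 5 / 7) * (763 / 343) * 1 := by
        nlinarith [mul_nonneg (sub_nonneg.2 hx1) (sub_nonneg.2 hx2),
          mul_nonneg (mul_nonneg (sub_nonneg.2 hx1) (sub_nonneg.2 hx2)) hx0.le]
      linarith
    · have hd0 : (0 : ℝ) < d := by positivity
      have hx : (2 / t) ^ d ≤ (5 / 7) ^ d := by
        refine pow_le_pow_left₀ hx0.le ?_ d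
        rw [div_le_iff₀ ht0]; linarith
      have hlog : 1 / 4 ≤ d * (3 / t - 1) := by
        have h1 := Real.log_lt_log (by norm_num) hA
        rw [Real.log_pow] at h1
        have h2 := Real.log_le_sub_one_of_pos (show 0 < 3 / t by positivity)
        have h3 := Real.one_sub_inv_le_log_of_pos (show (0 : ℝ) < 4 / 3 by norm_num)
        norm_num at h3
        nlinarith
      have h6 : d * (3 / t - 1) * t = d * (3 - t) := by field_simp
      have h7 : 7 / 10 ≤ d * (3 - t) := by rw [← h6]; nlinarith
      have h8 := nat_mul_pow_le hd
      have h9 : d * ((1 - 1 / 2) * (37 / 100) * (5 / 7) ^ d) ≤ d * ((3 - t) / 2) := by linarith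
      have h10 := le_of_mul_le_mul_left h9 hd0
      linarith

lemma halving_bound {d a n : ℕ} (hd : 3 ≤ d) {t : ℝ} (ht : 1 ≤ t) (ht2 : t < 2)
    (htn : t ^ (d + 1) = n) (h1 : 2 ^ a ≤ n) (h2 : n ≤ 2 ^ (a + 1)) :
    (d : ℝ) - 3 / 4 * a + 3 / 2 * (2 ^ a * (37 / 100 / n)) ≤ (3 / 2 * Real.sqrt d / t) ^ 2 := by
  have ht0 : 0 < t := by linarith
  have hd3 : (3 : ℝ) ≤ d := by exact_mod_cast hd
  have h1' : (2 : ℝ) ^ a ≤ n := by exact_mod_cast h1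
  have hn0 : (0 : ℝ) < n := lt_of_lt_of_le (by positivity) h1'
  have hmiss : (2 : ℝ) ^ a * (37 / 100 / n) ≤ 37 / 100 := by
    rw [mul_div_assoc', div_le_iff₀ hn0]; linarith
  have hl0 : 0 ≤ Real.log t := Real.log_nonneg ht
  have hl1 : Real.log t ≤ 0.6932 := by
    have := Real.log_le_log ht0 ht2.le
    linarith [Real.log_two_lt_d9]
  have ha : 1.44 * ((d + 1) * Real.log t) ≤ a + 1 := by
    have : Real.log (t ^ (d + 1)) ≤ Real.log (2 ^ (a + 1)) :=
      Real.log_le_log (by positivity) (by rw [htn]; exact_mod_cast h2)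
    rw [Real.log_pow, Real.log_pow] at this
    push_cast at this
    have hlog2 := Real.log_two_lt_d9
    have : ((a : ℝ) + 1) * Real.log 2 ≤ (a + 1) * 0.6931471808 := by gcongr
    linarith
  have hexp : 0.7356 * (1 - Real.log t) ≤ 1 / t ^ 2 := by
    have h3 : 1 / t ^ 2 = Real.exp (-1) * Real.exp (1 - 2 * Real.log t) := by
      rw [← Real.exp_add, show -1 + (1 - 2 * Real.log t) = -(Real.log t + Real.log t) by ring,
        Real.exp_neg, Real.exp_add, Real.exp_log ht0, one_div, sq]
    have h4 : 0.3678 ≤ Real.exp (-1) := by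
      rw [Real.exp_neg, le_inv_comm₀ (by norm_num) (Real.exp_pos 1)]
      have := Real.exp_one_lt_d9
      norm_num at this ⊢
      linarith
    have h5 := Real.add_one_le_exp (1 - 2 * Real.log t)
    rw [h3]
    calc _ = 0.3678 * (1 - 2 * Real.log t + 1) := by ring
      _ ≤ _ := by gcongr; linarith
  rw [div_pow, mul_pow, Real.sq_sqrt (by positivity)]
  calc _ ≤ (d : ℝ) * (9 / 4 * (0.7356 * (1 - Real.log t))) := by nlinarith
    _ ≤ d * (9 / 4 * (1 / t ^ 2)) := by gcongr
    _ = _ := by ring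

end Numeric

theorem integral_norm_sub_nn_le {d n : ℕ} (hd : 1 ≤ d) (hn : 1 ≤ n)
    {μ : Measure (EuclideanSpace ℝ (Fin d))} [IsProbabilityMeasure μ]
    (hsupp : ∀ᵐ x ∂μ, ∀ i, x i ∈ Set.Icc (0 : ℝ) 1)
    {nn : EuclideanSpace ℝ (Fin d) → (Fin n → EuclideanSpace ℝ (Fin d)) →
      EuclideanSpace ℝ (Fin d)}
    (hnn_meas : Measurable (Function.uncurry nn))
    (hnn_mem : ∀ x S, ∃ i, nn x S = S i)
    (hnn_min : ∀ x S i, ‖x - nn x S‖ ≤ ‖x - S i‖) :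
    ∫ z, ‖z.1 - nn z.1 z.2‖ ∂(μ.prod (Measure.pi fun _ : Fin n => μ)) ≤
      3 / 2 * Real.sqrt d / (n : ℝ) ^ ((1 : ℝ) / (d + 1)) := by
  have hn1 : (1 : ℝ) ≤ n := by exact_mod_cast hn
  set t : ℝ := (n : ℝ) ^ ((1 : ℝ) / (d + 1)) with ht_def
  have ht : 1 ≤ t := Real.one_le_rpow hn1 (by positivity)
  have ht0 : 0 < t := by linarith
  have htn : t ^ (d + 1) = n := by
    rw [ht_def, ← Real.rpow_natCast, ← Real.rpow_mul (by positivity)]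
    push_cast
    rw [one_div_mul_cancel (by positivity), Real.rpow_one]
  have hgrid : (∃ T, 1 ≤ T ∧ GridSuffices d t T) →
      ∫ z, ‖z.1 - nn z.1 z.2‖ ∂(μ.prod (Measure.pi fun _ : Fin n => μ)) ≤
        3 / 2 * Real.sqrt d / t := by
    rintro ⟨T, hT, h⟩
    have hT0 : (0 : ℝ) < T := by exact_mod_cast hT
    refine (integral_norm_sub_nn_le_uniform hn hsupp hnn_meas hnn_mem hnn_min hT).trans ?_
    calc _ = Real.sqrt d * (t / T + (1 - 1 / T) * (37 / 100) * (T / t) ^ d) / t := by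
          rw [← htn, div_pow, pow_succ]; field_simp
      _ ≤ Real.sqrt d * (3 / 2) / t := by gcongr; exact h
      _ = _ := by ring
  obtain rfl | rfl | hd3 : d = 1 ∨ d = 2 ∨ 3 ≤ d := by omega
  · exact hgrid (exists_gridSuffices_one ht)
  · exact hgrid (exists_gridSuffices_two ht)
  rcases le_or_gt 2 t with h2 | h2
  · exact hgrid (exists_gridSuffices_of_three_le hd3 h2)
  · have hlt : n < 2 ^ (d + 1) := by
      have : t ^ (d + 1) < 2 ^ (d + 1) := pow_lt_pow_left₀ h2 ht0.le (by omega)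
      rw [htn] at this
      exact_mod_cast this
    have ha : Nat.log 2 n ≤ d := Nat.lt_succ_iff.1 (Nat.log_lt_of_lt_pow (by omega) hlt)
    refine integral_norm_sub_nn_le_of_sq_le hsupp hnn_meas hnn_mem (by positivity) ?_
    exact (integral_norm_sub_nn_sq_le_halving hn hsupp hnn_meas hnn_mem hnn_min ha).trans
      (halving_bound hd3 ht h2 htn (Nat.pow_log_le_self 2 (by omega))
        (Nat.lt_pow_succ_log_self (by norm_num) n).le)

lemma min_le_disagreement {p q : ℝ} (hq : q ∈ Set.Icc (0 : ℝ) 1) :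
    min p (1 - p) ≤ p * (1 - q) + q * (1 - p) := by
  nlinarith [min_le_left p (1 - p), min_le_right p (1 - p), hq.1, hq.2]

lemma disagreement_le {p q : ℝ} (hp : p ∈ Set.Icc (0 : ℝ) 1) :
    p * (1 - q) + q * (1 - p) ≤ 2 * min p (1 - p) + |p - q| := by
  obtain ⟨h0, h1⟩ := hp
  have hm : p * (1 - p) ≤ min p (1 - p) := le_min (by nlinarith) (by nlinarith)
  have habs : (q - p) * (1 - 2 * p) ≤ |p - q| := by
    calc _ ≤ |(q - p) * (1 - 2 * p)| := le_abs_self _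
      _ = |p - q| * |1 - 2 * p| := by rw [abs_mul, abs_sub_comm]
      _ ≤ |p - q| * 1 := by gcongr; rw [abs_le]; constructor <;> linarith
      _ = _ := mul_one _
  nlinarith

end NearestNeighbor

open NearestNeighbor

/-- Expected risk of the 1-nearest-neighbor classifier trained on a sample with
symmetric label noise of rate `τ`.  For a query point `x` with true label
`y ~ Bernoulli (η x)` and nearest training point `nn x S` carrying a corrupted label
`ŷ ~ Bernoulli (η̂ (nn x S))` (independent of `y`), the probability of error is
`η x * (1 - η̂ (nn x S)) + η̂ (nn x S) * (1 - η x)`; the expected risk averages this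
over the query point and the `n` i.i.d. training instances. -/
theorem one_nn_noisy_risk_bounds (d n : ℕ) (hd : 1 ≤ d) (hn : 1 ≤ n)
    (μ : Measure (EuclideanSpace ℝ (Fin d))) [IsProbabilityMeasure μ]
    (hsupp : ∀ᵐ x ∂μ, ∀ i, x i ∈ Set.Icc (0:ℝ) 1)
    (η : EuclideanSpace ℝ (Fin d) → ℝ) (hηm : Measurable η)
    (hηrange : ∀ x, η x ∈ Set.Icc (0:ℝ) 1)
    (L : ℝ) (hL : 0 < L)
    (hLip : ∀ x x', |η x - η x'| ≤ L * ‖x - x'‖)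
    (τ : ℝ) (hτ : 0 ≤ τ) (hτ2 : τ < 1/2)
    (ηhat : EuclideanSpace ℝ (Fin d) → ℝ)
    (hηhat : ∀ x, ηhat x = (1 - 2 * τ) * η x + τ)
    (nn : EuclideanSpace ℝ (Fin d) → (Fin n → EuclideanSpace ℝ (Fin d)) →
      EuclideanSpace ℝ (Fin d))
    (hnn_meas : Measurable (Function.uncurry nn))
    (hnn_mem : ∀ x S, ∃ i, nn x S = S i)
    (hnn_min : ∀ x S i, ‖x - nn x S‖ ≤ ‖x - S i‖)
    (Rstar : ℝ) (hRstar : Rstar = ∫ x, min (η x) (1 - η x) ∂μ)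
    (ER : ℝ)
    (hER : ER = ∫ x, ∫ S, (η x * (1 - ηhat (nn x S)) + ηhat (nn x S) * (1 - η x))
      ∂(Measure.pi fun _ : Fin n => μ) ∂μ) :
    τ + (1 - 2 * τ) * (Rstar - 3 * L * Real.sqrt d / (2 * (n : ℝ) ^ ((1:ℝ) / (d + 1)))) ≤ ER ∧
    ER ≤ τ + (1 - 2 * τ) * (2 * Rstar + 3 * L * Real.sqrt d / (2 * (n : ℝ) ^ ((1:ℝ) / (d + 1)))) := by
  have hp : 0 < 1 - 2 * τ := by linarith
  have hn0 : (0 : ℝ) < n := by exact_mod_cast hn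
  set ν := μ.prod (Measure.pi fun _ : Fin n => μ) with hν
  have hnn' : Measurable fun z : EuclideanSpace ℝ (Fin d) ×
      (Fin n → EuclideanSpace ℝ (Fin d)) => η (nn z.1 z.2) := hηm.comp hnn_meas
  have hη1 : Measurable fun z : EuclideanSpace ℝ (Fin d) ×
      (Fin n → EuclideanSpace ℝ (Fin d)) => η z.1 := hηm.comp measurable_fst
  have hG : Integrable (fun z => η z.1 * (1 - η (nn z.1 z.2)) + η (nn z.1 z.2) * (1 - η z.1)) ν := by
    refine Integrable.of_bound (C := 1)
      ((hη1.mul (measurable_const.sub hnn')).add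
        (hnn'.mul (measurable_const.sub hη1))).aestronglyMeasurable (ae_of_all _ fun z => ?_)
    obtain ⟨a0, a1⟩ := hηrange z.1
    obtain ⟨b0, b1⟩ := hηrange (nn z.1 z.2)
    rw [Real.norm_eq_abs, abs_le]
    constructor <;> nlinarith [mul_nonneg a0 b0, mul_nonneg (sub_nonneg.2 a1) (sub_nonneg.2 b1),
      mul_nonneg a0 (sub_nonneg.2 b1), mul_nonneg b0 (sub_nonneg.2 a1)]
  have hM : Integrable (fun z => min (η z.1) (1 - η z.1)) ν := by
    refine Integrable.of_bound (C := 1)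
      (hη1.min (measurable_const.sub hη1)).aestronglyMeasurable (ae_of_all _ fun z => ?_)
    obtain ⟨a0, a1⟩ := hηrange z.1
    rw [Real.norm_eq_abs, abs_of_nonneg (le_min a0 (by linarith))]
    exact (min_le_left _ _).trans a1
  have hR : Rstar = ∫ z, min (η z.1) (1 - η z.1) ∂ν := by
    rw [hRstar, hν, integral_fun_fst (fun x => min (η x) (1 - η x))]
    simp
  have hE : ER = τ + (1 - 2 * τ) *
      ∫ z, (η z.1 * (1 - η (nn z.1 z.2)) + η (nn z.1 z.2) * (1 - η z.1)) ∂ν := by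
    have hrw : ∀ x S, η x * (1 - ηhat (nn x S)) + ηhat (nn x S) * (1 - η x) =
        τ + (1 - 2 * τ) * (η x * (1 - η (nn x S)) + η (nn x S) * (1 - η x)) := by
      intro x S; rw [hηhat]; ring
    have hint := (integrable_const τ).add (hG.const_mul (1 - 2 * τ))
    rw [hER]
    simp_rw [hrw]
    have hprod := integral_prod _ hint
    simp only [Pi.add_apply] at hprod
    rw [← hprod, ← hν, integral_add (integrable_const τ) (hG.const_mul _), integral_const_mul]
    simp
  have hD := integrable_norm_sub_nn_pow (n := n) hsupp hnn_meas hnn_mem 1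
  simp only [pow_one] at hD
  have hlow : Rstar ≤ ∫ z, (η z.1 * (1 - η (nn z.1 z.2)) + η (nn z.1 z.2) * (1 - η z.1)) ∂ν := by
    rw [hR]
    exact integral_mono hM hG fun z => min_le_disagreement (hηrange _)
  have hup : ∫ z, (η z.1 * (1 - η (nn z.1 z.2)) + η (nn z.1 z.2) * (1 - η z.1)) ∂ν ≤
      2 * Rstar + L * ∫ z, ‖z.1 - nn z.1 z.2‖ ∂ν := by
    rw [hR, ← integral_const_mul, ← integral_const_mul,
      ← integral_add (hM.const_mul _) (hD.const_mul _)]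
    refine integral_mono hG ((hM.const_mul _).add (hD.const_mul _)) fun z => ?_
    exact (disagreement_le (hηrange z.1)).trans (by simpa using hLip _ _)
  have hdist := mul_le_mul_of_nonneg_left
    (integral_norm_sub_nn_le hd hn hsupp hnn_meas hnn_mem hnn_min) hL.le
  rw [show L * (3 / 2 * Real.sqrt d / (n : ℝ) ^ ((1 : ℝ) / (d + 1))) =
    3 * L * Real.sqrt d / (2 * (n : ℝ) ^ ((1 : ℝ) / (d + 1))) by field_simp] at hdist
  have herr : 0 ≤ 3 * L * Real.sqrt d / (2 * (n : ℝ) ^ ((1 : ℝ) / (d + 1))) := by positivity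
  rw [hE]
  constructor
  · gcongr
    linarith
  · gcongr
    linarith
end
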